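/- Let R = k[y_0, y_12,...,y_45, y_1234,...,y_2345] and consider the element q = -y_0·y_2345 + y_45·y_23 - y_35·y_24 + y_34·y_25 together with the eight variables y_1234, y_1235, y_1245, y_1345, y_12, y_13, y_14, y_15. These nine elements form a regular sequence in R, so the ideal I_11 they generate is a complete intersection of height 9. -/

import Mathlib

namespace MvPolynomial

variable {σ R : Type*} [CommRing R]

open Classical in
/-- The substitution sending the variables in `S` to zero and fixing all other variables. -/
noncomputable def killVars (S : Set σ) : MvPolynomial σ R →ₐ[R] MvPolynomial σ R :=
  aeval fun i => if i ∈ S then 0 else X i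

lemma killVars_X_of_mem {S : Set σ} {i : σ} (h : i ∈ S) :
    killVars S (X i : MvPolynomial σ R) = 0 := by
  simp [killVars, h]

lemma killVars_X_of_notMem {S : Set σ} {i : σ} (h : i ∉ S) :
    killVars S (X i : MvPolynomial σ R) = X i := by
  simp [killVars, h]

lemma sub_killVars_mem (S : Set σ) (p : MvPolynomial σ R) :
    p - killVars S p ∈ Ideal.span (X '' S : Set (MvPolynomial σ R)) := by
  rw [← Ideal.Quotient.mk_eq_mk_iff_sub_mem]
  suffices h : (Ideal.Quotient.mkₐ R (Ideal.span (X '' S : Set (MvPolynomial σ R)))).comp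
      (killVars S) = Ideal.Quotient.mkₐ R _ from (DFunLike.congr_fun h p).symm
  ext i
  by_cases hi : i ∈ S
  · simp only [AlgHom.comp_apply, killVars_X_of_mem hi, map_zero]
    exact (Ideal.Quotient.eq_zero_iff_mem.2 (Ideal.subset_span (Set.mem_image_of_mem X hi))).symm
  · simp only [AlgHom.comp_apply, killVars_X_of_notMem hi]

lemma span_X_image_eq_ker_killVars (S : Set σ) :
    Ideal.span (X '' S : Set (MvPolynomial σ R)) = RingHom.ker (killVars (R := R) S) := by
  refine le_antisymm (Ideal.span_le.2 ?_) fun p hp => ?_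
  · rintro _ ⟨i, hi, rfl⟩
    exact killVars_X_of_mem hi
  · simpa [(RingHom.mem_ker).1 hp] using sub_killVars_mem S p

lemma mem_span_insert_X_image_iff {S : Set σ} {q : MvPolynomial σ R} (hq : killVars S q = q)
    (p : MvPolynomial σ R) :
    p ∈ Ideal.span (insert q (X '' S)) ↔ q ∣ killVars S p := by
  rw [Ideal.span_insert, Ideal.mem_span_singleton_sup]
  constructor
  · rintro ⟨a, b, hb, rfl⟩
    rw [span_X_image_eq_ker_killVars, RingHom.mem_ker] at hb
    simp [hq, hb]
  · rintro ⟨c, hc⟩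
    exact ⟨c, p - killVars S p, sub_killVars_mem S p, by rw [hc]; ring⟩

lemma dvd_of_dvd_X_mul [IsDomain R] {q p : MvPolynomial σ R} {j : σ} (hq0 : q ≠ 0)
    (hq : killVars {j} q = q) (h : q ∣ X j * p) : q ∣ p := by
  obtain ⟨b, hb⟩ := h
  have hkill : killVars {j} b = 0 := by
    have := congrArg (killVars {j}) hb
    rw [map_mul, map_mul, hq, killVars_X_of_mem (Set.mem_singleton j), zero_mul] at this
    exact (mul_eq_zero.1 this.symm).resolve_left hq0
  have hbj := sub_killVars_mem {j} b
  rw [hkill, sub_zero, Set.image_singleton, Ideal.mem_span_singleton] at hbj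
  obtain ⟨c, rfl⟩ := hbj
  exact ⟨c, mul_left_cancel₀ (X_ne_zero j) (by rw [hb]; ring)⟩

lemma ofList_cons_map_X (q : MvPolynomial σ R) (l : List σ) :
    Ideal.ofList (q :: l.map X) = Ideal.span (insert q (X '' {i | i ∈ l})) := by
  rw [Ideal.ofList]
  congr 1
  ext p
  simp [eq_comm]

lemma killVars_eq_self_of_forall {S : Set σ} {q : MvPolynomial σ R}
    (h : ∀ i ∈ q.vars, i ∉ S) : killVars S q = q := by
  conv_rhs => rw [← aeval_X_left_apply q]
  exact eval₂Hom_congr' rfl (fun i hi _ => by simp [h i hi]) rfl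

open RingTheory.Sequence in
/-- A nonzero polynomial followed by distinct variables not occurring in it is weakly regular. -/
theorem isWeaklyRegular_cons_map_X [IsDomain R] {q : MvPolynomial σ R} (hq0 : q ≠ 0)
    (l : List σ) (hl : l.Nodup) (hq : ∀ i ∈ q.vars, i ∉ l) :
    IsWeaklyRegular (MvPolynomial σ R) (q :: l.map X) := by
  induction l using List.reverseRecOn with
  | nil =>
    rw [List.map_nil, isWeaklyRegular_singleton_iff]
    exact fun a b h => mul_left_cancel₀ hq0 h
  | append_singleton l j ih =>
    have hl' := List.nodup_append.1 hl
    have hjl : j ∉ l := fun h => hl'.2.2 j h j (by simp) rfl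
    rw [List.map_append, ← List.cons_append, isWeaklyRegular_append_iff]
    refine ⟨ih hl'.1 fun i hi h => hq i hi (by simp [h]), ?_⟩
    rw [List.map_singleton, isWeaklyRegular_singleton_iff,
      isSMulRegular_quotient_iff_mem_of_smul_mem]
    intro p hp
    have hql : killVars {i | i ∈ l} q = q :=
      killVars_eq_self_of_forall fun i hi h => hq i hi (List.mem_append_left _ h)
    have hqj : killVars {j} q = q :=
      killVars_eq_self_of_forall fun i hi h => hq i hi (by simp_all)
    rw [smul_eq_mul, Ideal.mul_top, ofList_cons_map_X, mem_span_insert_X_image_iff hql] at hp ⊢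
    rw [smul_eq_mul, map_mul, killVars_X_of_notMem (S := {i | i ∈ l}) hjl] at hp
    exact dvd_of_dvd_X_mul hq0 hqj hp

lemma isPrime_span_X_image [IsDomain R] (S : Set σ) :
    (Ideal.span (X '' S : Set (MvPolynomial σ R))).IsPrime := by
  rw [span_X_image_eq_ker_killVars]
  exact RingHom.ker_isPrime _

lemma span_X_image_lt_of_notMem [Nontrivial R] {S : Set σ} {P : Ideal (MvPolynomial σ R)}
    (hS : X '' S ⊆ (P : Set (MvPolynomial σ R))) {p : MvPolynomial σ R} (hp : p ∈ P)
    (hp0 : killVars S p ≠ 0) : Ideal.span (X '' S : Set (MvPolynomial σ R)) < P := by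
  refine lt_of_le_of_ne (Ideal.span_le.2 hS) ?_
  rintro rfl
  rw [span_X_image_eq_ker_killVars] at hp
  exact hp0 hp

lemma length_le_height_of_X_mem [IsDomain R] (l : List σ) (hl : l.Nodup)
    (P : PrimeSpectrum (MvPolynomial σ R)) (hP : ∀ i ∈ l, X i ∈ P.asIdeal) :
    (l.length : ℕ∞) ≤ Order.height P := by
  induction l generalizing P with
  | nil => simp
  | cons j l ih =>
    obtain ⟨hj, hl⟩ := List.nodup_cons.1 hl
    let Q : PrimeSpectrum (MvPolynomial σ R) :=
      ⟨Ideal.span (X '' {i | i ∈ l}), isPrime_span_X_image _⟩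
    have hQP : Q < P := by
      refine span_X_image_lt_of_notMem ?_ (hP j (by simp)) (p := X j) ?_
      · rintro _ ⟨i, hi, rfl⟩
        exact hP i (List.mem_cons_of_mem _ hi)
      · rw [killVars_X_of_notMem (S := {i | i ∈ l}) hj]
        exact X_ne_zero j
    have hQ := ih hl Q fun i hi => Ideal.subset_span ⟨i, hi, rfl⟩
    rw [List.length_cons, Nat.cast_add, Nat.cast_one]
    exact (add_le_add_left hQ 1).trans (Order.height_add_one_le hQP)

/-- A prime containing distinct variables and a nonzero polynomial not involving them has height
greater than the number of these variables. -/
theorem length_add_one_le_height [IsDomain R] {q : MvPolynomial σ R} (hq0 : q ≠ 0)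
    (l : List σ) (hl : l.Nodup) (hq : ∀ i ∈ q.vars, i ∉ l)
    (P : PrimeSpectrum (MvPolynomial σ R)) (hqP : q ∈ P.asIdeal)
    (hP : ∀ i ∈ l, X i ∈ P.asIdeal) : (l.length : ℕ∞) + 1 ≤ Order.height P := by
  let Q : PrimeSpectrum (MvPolynomial σ R) :=
    ⟨Ideal.span (X '' {i | i ∈ l}), isPrime_span_X_image _⟩
  have hQP : Q < P := by
    refine span_X_image_lt_of_notMem ?_ hqP ?_
    · rintro _ ⟨i, hi, rfl⟩
      exact hP i hi
    · rwa [killVars_eq_self_of_forall (S := {i | i ∈ l}) hq]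
  have hQ := length_le_height_of_X_mem l hl Q fun i hi => Ideal.subset_span ⟨i, hi, rfl⟩
  exact (add_le_add_left hQ 1).trans (Order.height_add_one_le hQP)

open RingTheory.Sequence in
theorem isRegular_cons_map_X [IsDomain R] {q : MvPolynomial σ R} (hq0 : q ≠ 0)
    (hqc : constantCoeff q = 0) (l : List σ) (hl : l.Nodup) (hq : ∀ i ∈ q.vars, i ∉ l) :
    IsRegular (MvPolynomial σ R) (q :: l.map X) := by
  refine ⟨isWeaklyRegular_cons_map_X hq0 l hl hq, fun h => ?_⟩
  rw [smul_eq_mul, Ideal.mul_top] at h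
  have hle : Ideal.ofList (q :: l.map X) ≤ RingHom.ker (constantCoeff (R := R) (σ := σ)) := by
    rw [ofList_cons_map_X, Ideal.span_le]
    rintro _ (rfl | ⟨i, -, rfl⟩)
    · exact hqc
    · simp
  exact RingHom.ker_ne_top _ (top_le_iff.1 (h ▸ hle))

/-- The ideal generated by a nonzero polynomial without constant term and by distinct variables not
occurring in it has height one more than the number of these variables. -/
theorem iInf_height_span_insert_X_image [IsDomain R] [IsNoetherianRing R] [Finite σ]
    {q : MvPolynomial σ R} (hq0 : q ≠ 0) (hqc : constantCoeff q = 0) (l : List σ) (hl : l.Nodup)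
    (hq : ∀ i ∈ q.vars, i ∉ l) :
    (⨅ (P : PrimeSpectrum (MvPolynomial σ R))
      (_ : Ideal.ofList (q :: l.map X) ≤ P.asIdeal), Order.height P) = l.length + 1 := by
  refine le_antisymm ?_ (le_iInf₂ fun P hP => length_add_one_le_height hq0 l hl hq P
    (hP (Ideal.subset_span (by simp))) fun i hi => hP (Ideal.subset_span (by simp [hi])))
  have hne : Ideal.ofList (q :: l.map X) ≠ ⊤ := fun h =>
    (isRegular_cons_map_X hq0 hqc l hl hq).top_ne_smul (by rw [h]; simp)
  obtain ⟨P, hP⟩ := Ideal.nonempty_minimalPrimes hne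
  have hprime : P.IsPrime := hP.1.1
  refine (iInf₂_le ⟨P, hprime⟩ hP.1.2).trans ?_
  rw [← PrimeSpectrum.height_eq_orderHeight]
  classical
  have hfin : Ideal.ofList (q :: l.map X) = Ideal.span ((q :: l.map X).toFinset : Set _) := by
    rw [List.coe_toFinset, Ideal.ofList]
  refine (Ideal.height_le_card_of_mem_minimalPrimes_span_finset (hfin ▸ hP)).trans ?_
  exact_mod_cast (List.toFinset_card_le (q :: l.map X)).trans (by simp)

end MvPolynomial


open MvPolynomial RingTheory in
/-- Variables of `MvPolynomial (Fin 16) k`: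
`X 0 = y₀, X 1 = y₁₂, X 2 = y₁₃, X 3 = y₁₄, X 4 = y₁₅, X 5 = y₂₃, X 6 = y₂₄, X 7 = y₂₅,
 X 8 = y₃₄, X 9 = y₃₅, X 10 = y₄₅, X 11 = y₁₂₃₄, X 12 = y₁₂₃₅, X 13 = y₁₂₄₅,
 X 14 = y₁₃₄₅, X 15 = y₂₃₄₅`.
The element `q = -y₀y₂₃₄₅ + y₄₅y₂₃ - y₃₅y₂₄ + y₃₄y₂₅` together with the eight variables
`y₁₂₃₄, y₁₂₃₅, y₁₂₄₅, y₁₃₄₅, y₁₂, y₁₃, y₁₄, y₁₅` forms a regular sequence, so the ideal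
they generate is a complete intersection of height 9. -/
theorem stmt19 (k : Type*) [Field k]
    (q : MvPolynomial (Fin 16) k)
    (hq : q = -(X 0 * X 15) + X 10 * X 5 - X 9 * X 6 + X 8 * X 7) :
    Sequence.IsRegular (MvPolynomial (Fin 16) k)
      [q, X 11, X 12, X 13, X 14, X 1, X 2, X 3, X 4] ∧
    (⨅ (P : PrimeSpectrum (MvPolynomial (Fin 16) k))
        (_ : Ideal.span {q, X 11, X 12, X 13, X 14, X 1, X 2, X 3, X 4} ≤ P.asIdeal),
        Order.height P) = 9 := by
  have hq0 : q ≠ 0 := by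
    intro h
    have := congrArg (eval fun i : Fin 16 => if i = 7 ∨ i = 8 then (1 : k) else 0) (hq.symm.trans h)
    simp [Fin.ext_iff] at this
  have hqc : constantCoeff q = 0 := by simp [hq]
  have hvars : ∀ i ∈ q.vars, i ∉ ([11, 12, 13, 14, 1, 2, 3, 4] : List (Fin 16)) := by
    have hsupp : q ∈ supported k ({0, 15, 10, 5, 9, 6, 8, 7} : Set (Fin 16)) := by
      have hX {i : Fin 16} (hi : i ∈ ({0, 15, 10, 5, 9, 6, 8, 7} : Set (Fin 16))) :
          (X i : MvPolynomial (Fin 16) k) ∈ supported k {0, 15, 10, 5, 9, 6, 8, 7} :=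
        X_mem_supported.2 hi
      rw [hq]
      exact add_mem (sub_mem (add_mem (neg_mem (mul_mem (hX (by simp)) (hX (by simp))))
        (mul_mem (hX (by simp)) (hX (by simp)))) (mul_mem (hX (by simp)) (hX (by simp))))
        (mul_mem (hX (by simp)) (hX (by simp)))
    intro i hi
    have := mem_supported.1 hsupp hi
    simp only [Set.mem_insert_iff, Set.mem_singleton_iff] at this
    rcases this with rfl | rfl | rfl | rfl | rfl | rfl | rfl | rfl <;> decide
  refine ⟨isRegular_cons_map_X hq0 hqc [11, 12, 13, 14, 1, 2, 3, 4] (by decide) hvars, ?_⟩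
  have hspan : Ideal.span {q, X 11, X 12, X 13, X 14, X 1, X 2, X 3, X 4} =
      Ideal.ofList (q :: ([11, 12, 13, 14, 1, 2, 3, 4] : List (Fin 16)).map X) := by
    congr 1
    ext p
    simp
  rw [hspan, iInf_height_span_insert_X_image hq0 hqc _ (by decide) hvars]
  norm_num
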